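/- Let L > 0 and let v = (v₁,v₂) : ℝ² → ℝ² be a smooth L-periodic divergence-free vector field. Then ∫_{[0,L]²} (∂_{yy} v₁)(Δ v₁) dx + ∫_{[0,L]²} (∂_{xx} v₂)(Δ v₂) dx = ∫_{[0,L]²} [(∂_{xx} v₁)² + (∂_{yy} v₁)² + (∂_{xx} v₂)² + (∂_{yy} v₂)²] dx ≥ (1/2) ∫_{[0,L]²} (|Δ v₁|² + |Δ v₂|²) dx. -/

import Mathlib

open MeasureTheory Real Filter

noncomputable def pdX (f : ℝ × ℝ → ℝ) : ℝ × ℝ → ℝ := fun p => fderiv ℝ f p (1, 0)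

noncomputable def pdY (f : ℝ × ℝ → ℝ) : ℝ × ℝ → ℝ := fun p => fderiv ℝ f p (0, 1)

noncomputable def lap (f : ℝ × ℝ → ℝ) : ℝ × ℝ → ℝ := fun p => pdX (pdX f) p + pdY (pdY f) p

/-- `f` is `L`-periodic in each coordinate. -/
def IsPeriodicL (L : ℝ) (f : ℝ × ℝ → ℝ) : Prop :=
  (∀ p : ℝ × ℝ, f (p.1 + L, p.2) = f p) ∧ (∀ p : ℝ × ℝ, f (p.1, p.2 + L) = f p)

/-- The fundamental square `[0,L] × [0,L]`. -/
def Torus (L : ℝ) : Set (ℝ × ℝ) := Set.Icc (0:ℝ) L ×ˢ Set.Icc (0:ℝ) L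

theorem contDiff_pdX {f : ℝ × ℝ → ℝ} (hf : ContDiff ℝ (⊤ : ℕ∞) f) :
    ContDiff ℝ (⊤ : ℕ∞) (pdX f) :=
  (hf.fderiv_right (m := (⊤ : ℕ∞)) le_rfl).clm_apply contDiff_const

theorem contDiff_pdY {f : ℝ × ℝ → ℝ} (hf : ContDiff ℝ (⊤ : ℕ∞) f) :
    ContDiff ℝ (⊤ : ℕ∞) (pdY f) :=
  (hf.fderiv_right (m := (⊤ : ℕ∞)) le_rfl).clm_apply contDiff_const

theorem fderiv_eq_of_translation_invariant {f : ℝ × ℝ → ℝ} {c : ℝ × ℝ}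
    (h : ∀ p, f (p + c) = f p) (p : ℝ × ℝ) : fderiv ℝ f (p + c) = fderiv ℝ f p := by
  rw [← fderiv_comp_add_right]
  exact congrArg (fun g => fderiv ℝ g p) (funext h)

theorem IsPeriodicL.fderiv_apply {L : ℝ} {f : ℝ × ℝ → ℝ} (h : IsPeriodicL L f) (w : ℝ × ℝ) :
    IsPeriodicL L (fun p => fderiv ℝ f p w) := by
  constructor <;> intro p
  · have := fderiv_eq_of_translation_invariant (c := (L, 0))
      (fun p => by simpa [Prod.add_def] using h.1 p) p
    simpa [Prod.add_def] using congrArg (fun A : ℝ × ℝ →L[ℝ] ℝ => A w) this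
  · have := fderiv_eq_of_translation_invariant (c := (0, L))
      (fun p => by simpa [Prod.add_def] using h.2 p) p
    simpa [Prod.add_def] using congrArg (fun A : ℝ × ℝ →L[ℝ] ℝ => A w) this

theorem IsPeriodicL.mul {L : ℝ} {f g : ℝ × ℝ → ℝ} (hf : IsPeriodicL L f)
    (hg : IsPeriodicL L g) : IsPeriodicL L (fun p => f p * g p) :=
  ⟨fun p => congrArg₂ (· * ·) (hf.1 p) (hg.1 p),
    fun p => congrArg₂ (· * ·) (hf.2 p) (hg.2 p)⟩

theorem pdX_pdY_comm {f : ℝ × ℝ → ℝ} (hf : ContDiff ℝ (⊤ : ℕ∞) f) :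
    pdX (pdY f) = pdY (pdX f) := by
  funext p
  have hd : DifferentiableAt ℝ (fderiv ℝ f) p :=
    (hf.fderiv_right (m := (⊤ : ℕ∞)) le_rfl).differentiable (by simp) p
  have hs : IsSymmSndFDerivAt ℝ f p :=
    hf.contDiffAt.isSymmSndFDerivAt (by
      rw [minSmoothness_of_isRCLikeNormedField]
      exact WithTop.coe_le_coe.2 le_top)
  have key (u w : ℝ × ℝ) :
      fderiv ℝ (fun q => fderiv ℝ f q w) p u = fderiv ℝ (fderiv ℝ f) p u w := by
    rw [fderiv_clm_apply hd (differentiableAt_const w)]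
    simp
  exact (key _ _).trans ((hs _ _).trans (key _ _).symm)

theorem pdX_neg (f : ℝ × ℝ → ℝ) (p : ℝ × ℝ) : pdX (fun q => -f q) p = -pdX f p := by
  simp [pdX, fderiv_fun_neg]

theorem pdY_neg (f : ℝ × ℝ → ℝ) (p : ℝ × ℝ) : pdY (fun q => -f q) p = -pdY f p := by
  simp [pdY, fderiv_fun_neg]

theorem pdX_mul {f g : ℝ × ℝ → ℝ} (hf : ContDiff ℝ (⊤ : ℕ∞) f) (hg : ContDiff ℝ (⊤ : ℕ∞) g)
    (p : ℝ × ℝ) : pdX (fun q => f q * g q) p = f p * pdX g p + g p * pdX f p := by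
  simp [pdX, fderiv_fun_mul (hf.differentiable (by simp) p) (hg.differentiable (by simp) p)]

theorem pdY_mul {f g : ℝ × ℝ → ℝ} (hf : ContDiff ℝ (⊤ : ℕ∞) f) (hg : ContDiff ℝ (⊤ : ℕ∞) g)
    (p : ℝ × ℝ) : pdY (fun q => f q * g q) p = f p * pdY g p + g p * pdY f p := by
  simp [pdY, fderiv_fun_mul (hf.differentiable (by simp) p) (hg.differentiable (by simp) p)]

theorem integrableOn_torus (L : ℝ) {f : ℝ × ℝ → ℝ} (hf : Continuous f) :
    IntegrableOn f (Torus L) :=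
  hf.continuousOn.integrableOn_compact (isCompact_Icc.prod isCompact_Icc)

/-- The divergence of a smooth periodic field integrates to zero over the torus. -/
theorem integral_torus_divergence {L : ℝ} (hL : 0 ≤ L) {f g : ℝ × ℝ → ℝ}
    (hf : ContDiff ℝ (⊤ : ℕ∞) f) (hg : ContDiff ℝ (⊤ : ℕ∞) g)
    (hpf : IsPeriodicL L f) (hpg : IsPeriodicL L g) :
    ∫ p in Torus L, (pdX f p + pdY g p) = 0 := by
  have hT : Torus L = Set.Icc ((0, 0) : ℝ × ℝ) (L, L) := Set.Icc_prod_Icc ..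
  have hX (y : ℝ) : f (L, y) = f (0, y) := by simpa using hpf.1 (0, y)
  have hY (x : ℝ) : g (x, L) = g (x, 0) := by simpa using hpg.2 (x, 0)
  have hi := integrableOn_torus L
    ((contDiff_pdX hf).continuous.add (contDiff_pdY hg).continuous)
  rw [hT] at hi ⊢
  refine (integral_divergence_prod_Icc_of_hasFDerivAt_of_le f g (fderiv ℝ f) (fderiv ℝ g)
    (0, 0) (L, L) ⟨hL, hL⟩ hf.continuous.continuousOn hg.continuous.continuousOn
    (fun p _ => (hf.differentiable (by simp) p).hasFDerivAt)
    (fun p _ => (hg.differentiable (by simp) p).hasFDerivAt) hi).trans ?_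
  simp [hX, hY]

/-- Integrating by parts twice moves one derivative across in `∫ (∂_{yy} f)(∂_{xx} f)`. -/
theorem integral_torus_pdYY_mul_pdXX {L : ℝ} (hL : 0 ≤ L) {f : ℝ × ℝ → ℝ}
    (hf : ContDiff ℝ (⊤ : ℕ∞) f) (hp : IsPeriodicL L f) :
    ∫ p in Torus L, pdY (pdY f) p * pdX (pdX f) p = ∫ p in Torus L, (pdX (pdY f) p) ^ 2 := by
  have hx := contDiff_pdX hf
  have hy := contDiff_pdY hf
  have hxx := contDiff_pdX hx
  have hyy := contDiff_pdY hy
  have hxy := contDiff_pdX hy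
  have hpx : IsPeriodicL L (pdX f) := hp.fderiv_apply _
  have hpy : IsPeriodicL L (pdY f) := hp.fderiv_apply _
  have hpyy : IsPeriodicL L (pdY (pdY f)) := hpy.fderiv_apply _
  have hpxy : IsPeriodicL L (pdX (pdY f)) := hpy.fderiv_apply _
  have h := integral_torus_divergence hL (hyy.mul hx) (hxy.mul hx.neg)
    (hpyy.mul hpx) (hpxy.mul ⟨fun p => congrArg Neg.neg (hpx.1 p),
      fun p => congrArg Neg.neg (hpx.2 p)⟩)
  rw [← sub_eq_zero, ← integral_sub
    (integrableOn_torus L (hyy.continuous.fun_mul hxx.continuous))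
    (integrableOn_torus L (hxy.continuous.fun_pow 2)), ← h]
  congr 1
  funext p
  rw [pdX_mul hyy hx, pdY_mul hxy hx.neg, pdY_neg, pdX_pdY_comm hy, pdX_pdY_comm hf]
  ring

/-- Second-order anisotropic coercivity (3.10)–(3.12): for a smooth `L`-periodic
divergence-free vector field `v = (v₁,v₂)`,
`∫ (∂_{yy} v₁)(Δ v₁) + ∫ (∂_{xx} v₂)(Δ v₂)
  = ∫ [(∂_{xx}v₁)² + (∂_{yy}v₁)² + (∂_{xx}v₂)² + (∂_{yy}v₂)²]
  ≥ (1/2) ∫ (|Δ v₁|² + |Δ v₂|²)`. -/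
theorem aniso_coercivity_second_order (L : ℝ) (hL : 0 < L)
    (v₁ v₂ : ℝ × ℝ → ℝ)
    (hsv₁ : ContDiff ℝ (⊤ : ℕ∞) v₁) (hsv₂ : ContDiff ℝ (⊤ : ℕ∞) v₂)
    (hpv₁ : IsPeriodicL L v₁) (hpv₂ : IsPeriodicL L v₂)
    (hdiv : ∀ p : ℝ × ℝ, pdX v₁ p + pdY v₂ p = 0) :
    ((∫ p in Torus L, (pdY (pdY v₁) p) * (lap v₁ p)) +
        (∫ p in Torus L, (pdX (pdX v₂) p) * (lap v₂ p)) =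
      ∫ p in Torus L,
        ((pdX (pdX v₁) p)^2 + (pdY (pdY v₁) p)^2 +
          (pdX (pdX v₂) p)^2 + (pdY (pdY v₂) p)^2)) ∧
    (1/2) * (∫ p in Torus L, ((lap v₁ p)^2 + (lap v₂ p)^2)) ≤
      ∫ p in Torus L,
        ((pdX (pdX v₁) p)^2 + (pdY (pdY v₁) p)^2 +
          (pdX (pdX v₂) p)^2 + (pdY (pdY v₂) p)^2) := by
  have c {f : ℝ × ℝ → ℝ} (hf : ContDiff ℝ (⊤ : ℕ∞) f) :
      Continuous (pdX (pdX f)) ∧ Continuous (pdY (pdY f)) :=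
    ⟨(contDiff_pdX (contDiff_pdX hf)).continuous, (contDiff_pdY (contDiff_pdY hf)).continuous⟩
  obtain ⟨c₁x, c₁y⟩ := c hsv₁
  obtain ⟨c₂x, c₂y⟩ := c hsv₂
  have hd : pdX v₁ = fun p => -pdY v₂ p := funext fun p => eq_neg_of_add_eq_zero_left (hdiv p)
  have hxx (p : ℝ × ℝ) : pdX (pdX v₁) p = -pdX (pdY v₂) p := by
    rw [hd, pdX_neg]
  have hxy (p : ℝ × ℝ) : pdX (pdY v₁) p = -pdY (pdY v₂) p := by
    rw [pdX_pdY_comm hsv₁, hd, pdY_neg]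
  constructor
  · have h₁ : ∫ p in Torus L, pdY (pdY v₁) p * pdX (pdX v₁) p =
        ∫ p in Torus L, (pdY (pdY v₂) p) ^ 2 := by
      simpa only [hxy, neg_sq] using integral_torus_pdYY_mul_pdXX hL.le hsv₁ hpv₁
    have h₂ : ∫ p in Torus L, pdY (pdY v₂) p * pdX (pdX v₂) p =
        ∫ p in Torus L, (pdX (pdX v₁) p) ^ 2 := by
      simpa only [hxx, neg_sq] using integral_torus_pdYY_mul_pdXX hL.le hsv₂ hpv₂
    have i {f : ℝ × ℝ → ℝ} (hf : Continuous f) := integrableOn_torus L hf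
    simp only [lap, mul_add]
    rw [integral_add (i (c₁y.fun_mul c₁x)) (i (c₁y.fun_mul c₁y)),
      integral_add (i (c₂x.fun_mul c₂x)) (i (c₂x.fun_mul c₂y)), h₁,
      integral_add (i (((c₁x.fun_pow 2).fun_add (c₁y.fun_pow 2)).fun_add (c₂x.fun_pow 2))) (i (c₂y.fun_pow 2)),
      integral_add (i ((c₁x.fun_pow 2).fun_add (c₁y.fun_pow 2))) (i (c₂x.fun_pow 2)),
      integral_add (i (c₁x.fun_pow 2)) (i (c₁y.fun_pow 2)), ← h₂]
    simp only [mul_comm (pdX (pdX v₂) _) (pdY (pdY v₂) _), ← sq]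
    ring
  · rw [← integral_const_mul]
    refine integral_mono (integrableOn_torus L ?_) (integrableOn_torus L ?_) fun p => ?_
    · unfold lap
      fun_prop
    · fun_prop
    · simp only [lap]
      nlinarith [sq_nonneg (pdX (pdX v₁) p - pdY (pdY v₁) p),
        sq_nonneg (pdX (pdX v₂) p - pdY (pdY v₂) p)]
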